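/- Let K be a field, let k < n be non-negative integers, and let P be a 2n×2n matrix over K with rk(P) = k and let Q be an n×n matrix with rk(Q) ≤ k. Then P is similar to a 2n×2n block matrix whose top-left n×n block equals Q, i.e., there exist n×n matrices Q_12, Q_21, Q_22 such that P ∼ [[Q, Q_12],[Q_21, Q_22]]. -/

import Mathlib

/-- Two square matrices are similar if they are conjugate by an invertible matrix. -/
def MatSimilar {K : Type*} [Field K] {m : Type*} [Fintype m] [DecidableEq m]
    (P Q : Matrix m m K) : Prop :=
  ∃ A : (Matrix m m K)ˣ,
    Q = (A : Matrix m m K) * P * ((A⁻¹ : (Matrix m m K)ˣ) : Matrix m m K)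

open Module in
theorem aux_sub {K V : Type*} [Field K] [AddCommGroup V] [Module K V] [FiniteDimensional K V] :
    ∀ (d : ℕ) (R N : Submodule K V), finrank K R + d ≤ finrank K V →
      finrank K V ≤ finrank K N + d →
      ∃ U : Submodule K V, finrank K U = d ∧ Disjoint R U ∧ N ⊔ U = ⊤ := by
  intro d
  induction d with
  | zero =>
    intro R N _ h2
    refine ⟨⊥, by simp, disjoint_bot_right, ?_⟩
    rw [sup_bot_eq]
    exact Submodule.eq_top_of_finrank_eq (le_antisymm (Submodule.finrank_le N) h2)
  | succ d ih =>
    intro R N h1 h2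
    have hR : ∃ v, v ∉ R := by
      by_contra! h
      have : R = ⊤ := by ext; simp [h]
      subst this
      simp at h1
    have key : ∃ v, v ∉ R ∧ (v ∈ N → N = ⊤) := by
      obtain ⟨v, hv⟩ := hR
      by_cases hN : N = ⊤
      · exact ⟨v, hv, fun _ => hN⟩
      by_cases hvN : v ∈ N
      · have : ∃ w, w ∉ N := by
          by_contra! h
          exact hN (by ext; simp [h])
        obtain ⟨w, hw⟩ := this
        by_cases hwR : w ∈ R
        · refine ⟨v + w, ?_, ?_⟩
          · rwa [Submodule.add_mem_iff_left _ hwR]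
          · intro h
            exact absurd ((Submodule.add_mem_iff_right _ hvN).1 h) hw
        · exact ⟨w, hwR, fun h => absurd h hw⟩
      · exact ⟨v, hv, fun h => absurd h hvN⟩
    obtain ⟨v, hvR, hvN⟩ := key
    have e1 := Submodule.finrank_sup_span_singleton (K := K) hvR
    have e2 : finrank K V ≤ finrank K (N ⊔ Submodule.span K {v} : Submodule K V) + d := by
      by_cases h : v ∈ N
      · rw [hvN h, top_sup_eq, finrank_top]; omega
      · rw [Submodule.finrank_sup_span_singleton h]; omega
    obtain ⟨U, hU, hd, hs⟩ := ih (R ⊔ Submodule.span K {v}) (N ⊔ Submodule.span K {v})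
      (by omega) e2
    have hv0 : v ≠ 0 := fun h => hvR (h ▸ R.zero_mem)
    have hvU : v ∉ U := fun h => hv0 (Submodule.disjoint_def.1 hd v
      (Submodule.mem_sup_right (Submodule.mem_span_singleton_self v)) h)
    refine ⟨Submodule.span K {v} ⊔ U, ?_, ?_, ?_⟩
    · rw [sup_comm, Submodule.finrank_sup_span_singleton hvU, hU]
    · refine Disjoint.disjoint_sup_right_of_disjoint_sup_left ?_ hd
      exact (Submodule.disjoint_span_singleton' hv0).2 hvR
    · rw [← sup_assoc, hs]

theorem aux_factor {K X V Y : Type*} [Field K] [AddCommGroup X] [Module K X]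
    [AddCommGroup V] [Module K V] [AddCommGroup Y] [Module K Y]
    (g : X →ₗ[K] V) (h : X →ₗ[K] Y) (hk : ∀ x, g x = 0 → h x = 0) :
    ∃ p : V →ₗ[K] Y, ∀ x, p (g x) = h x := by
  obtain ⟨p, hp⟩ := LinearMap.exists_extend
    (((LinearMap.ker g).liftQ h (fun x hx => hk x hx)) ∘ₗ g.quotKerEquivRange.symm.toLinearMap)
  refine ⟨p, fun x => ?_⟩
  have := LinearMap.congr_fun hp ⟨g x, x, rfl⟩
  simp only [LinearMap.comp_apply, Submodule.subtype_apply, LinearEquiv.coe_coe] at this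
  rw [this]
  have e : g.quotKerEquivRange.symm ⟨g x, x, rfl⟩ = (LinearMap.ker g).mkQ x := by
    rw [LinearEquiv.symm_apply_eq]; rfl
  rw [e]; rfl

open Module in
theorem aux_main {K V : Type*} [Field K] [AddCommGroup V] [Module K V] [FiniteDimensional K V]
    (n k : ℕ) (hkn : k ≤ n) (hV : finrank K V = n + n) (f : V →ₗ[K] V)
    (hf : finrank K (LinearMap.range f) = k)
    (q : (Fin n → K) →ₗ[K] (Fin n → K)) (hq : finrank K (LinearMap.range q) ≤ k) :
    ∃ (u : (Fin n → K) →ₗ[K] V) (p : V →ₗ[K] (Fin n → K)),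
      (∀ x, p (u x) = x) ∧ ∀ x, p (f (u x)) = q x := by
  have rn := LinearMap.finrank_range_add_finrank_ker f
  obtain ⟨U, hU, hd, hs⟩ := aux_sub n (LinearMap.range f) (LinearMap.ker f) (by omega) (by omega)
  let e : (Fin n → K) ≃ₗ[K] U := LinearEquiv.ofFinrankEq _ _ (by simp [hU])
  let t : (Fin n → K) →ₗ[K] V := f ∘ₗ U.subtype ∘ₗ e.toLinearMap
  have ht : LinearMap.range t = LinearMap.range f := by
    apply le_antisymm
    · rintro _ ⟨x, rfl⟩
      exact ⟨_, rfl⟩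
    · rintro _ ⟨x, rfl⟩
      have hx : x ∈ LinearMap.ker f ⊔ U := hs ▸ Submodule.mem_top
      obtain ⟨a, ha, b, hb, rfl⟩ := Submodule.mem_sup.1 hx
      refine ⟨e.symm ⟨b, hb⟩, ?_⟩
      simp [t, LinearMap.mem_ker.1 ha]
  have rt := LinearMap.finrank_range_add_finrank_ker t
  have rq := LinearMap.finrank_range_add_finrank_ker q
  rw [ht] at rt
  obtain ⟨j, hj⟩ := (finrank_le_iff_exists_linearMap (R := K) (M := LinearMap.ker t)
    (M' := LinearMap.ker q)).1 (by omega)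
  let j' : LinearMap.ker t →ₗ[K] (Fin n → K) := (LinearMap.ker q).subtype ∘ₗ j
  have hj' : Function.Injective j' := Subtype.val_injective.comp hj
  obtain ⟨g, hg⟩ := Submodule.exists_linearEquiv_restrict_eq (LinearEquiv.ofInjective j' hj')
  let u : (Fin n → K) →ₗ[K] V := U.subtype ∘ₗ e.toLinearMap ∘ₗ g.symm.toLinearMap
  have huU : ∀ x, u x ∈ U := fun x => (e (g.symm x)).2
  have hui : ∀ x, u x = 0 → x = 0 := by
    intro x hx
    simpa [u] using hx
  have huq : ∀ y, f (u y) = 0 → q y = 0 := by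
    intro y hy
    have h1 : g.symm y ∈ LinearMap.ker t := hy
    have h2 := hg ⟨_, h1⟩
    simp only [LinearEquiv.apply_symm_apply] at h2
    rw [← h2]
    exact (j ⟨_, h1⟩).2
  obtain ⟨p, hp⟩ := aux_factor (u.coprod (f ∘ₗ u)) (LinearMap.id.coprod q) (by
    rintro ⟨x, y⟩ h
    simp only [LinearMap.coprod_apply, LinearMap.comp_apply, LinearMap.id_apply] at h ⊢
    have h1 : f (u y) = 0 := by
      refine Submodule.disjoint_def.1 hd _ ⟨_, rfl⟩ ?_
      rw [eq_neg_of_add_eq_zero_right h]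
      exact U.neg_mem (huU x)
    rw [h1, add_zero] at h
    rw [hui x h, huq y h1, add_zero])
  refine ⟨u, p, fun x => ?_, fun x => ?_⟩
  · simpa using hp (x, 0)
  · simpa using hp (0, x)

open Module in
theorem aux_equiv {K V : Type*} [Field K] [AddCommGroup V] [Module K V] [FiniteDimensional K V]
    (n : ℕ) (hV : finrank K V = n + n)
    (u : (Fin n → K) →ₗ[K] V) (p : V →ₗ[K] (Fin n → K)) (h : ∀ x, p (u x) = x) :
    ∃ E : V ≃ₗ[K] ((Fin n → K) × (Fin n → K)), (∀ v, (E v).1 = p v) ∧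
      ∀ x, E.symm (x, 0) = u x := by
  have hs : LinearMap.range p = ⊤ := LinearMap.range_eq_top.2 fun x => ⟨u x, h x⟩
  have rn := LinearMap.finrank_range_add_finrank_ker p
  rw [hs] at rn
  simp only [finrank_top, finrank_fintype_fun_eq_card, Fintype.card_fin] at rn
  let c : LinearMap.ker p ≃ₗ[K] (Fin n → K) := LinearEquiv.ofFinrankEq _ _ (by simp; omega)
  let L : ((Fin n → K) × (Fin n → K)) →ₗ[K] V :=
    u.coprod ((LinearMap.ker p).subtype ∘ₗ c.symm.toLinearMap)
  have hL : ∀ x y, L (x, y) = u x + c.symm y := fun x y => rfl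
  have hpL : ∀ x y, p (L (x, y)) = x := by
    intro x y
    rw [hL, map_add, h, LinearMap.mem_ker.1 (c.symm y).2, add_zero]
  have hi : Function.Injective L := by
    rw [injective_iff_map_eq_zero]
    rintro ⟨x, y⟩ hxy
    have hx : x = 0 := by rw [← hpL x y, hxy, map_zero]
    subst hx
    rw [hL] at hxy
    simpa using hxy
  let E := LinearEquiv.ofInjectiveOfFinrankEq L hi (by simp [hV])
  have hE : ∀ z, E z = L z := fun z => rfl
  refine ⟨E.symm, fun v => ?_, fun x => ?_⟩
  · obtain ⟨⟨x, y⟩, rfl⟩ := E.surjective v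
    rw [LinearEquiv.symm_apply_apply, hE, hpL]
  · rw [LinearEquiv.symm_symm, hE, hL]; simp

/-- A `2n × 2n` matrix of rank `k < n` is similar to a block matrix whose top-left
`n × n` block is any prescribed `n × n` matrix `Q` of rank at most `k`. -/
theorem similar_to_block_with_prescribed_corner {K : Type*} [Field K]
    (k n : ℕ) (hkn : k < n)
    (P : Matrix (Fin (n + n)) (Fin (n + n)) K) (hP : P.rank = k)
    (Q : Matrix (Fin n) (Fin n) K) (hQ : Q.rank ≤ k) :
    ∃ Q12 Q21 Q22 : Matrix (Fin n) (Fin n) K,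
      MatSimilar P
        ((Matrix.fromBlocks Q Q12 Q21 Q22).submatrix
          (⇑finSumFinEquiv.symm) (⇑finSumFinEquiv.symm)) := by
  obtain ⟨u, p, h1, h2⟩ := aux_main n k hkn.le (by simp) P.mulVecLin hP Q.mulVecLin hQ
  obtain ⟨E, hE1, hE2⟩ := aux_equiv n (by simp) u p h1
  let F : (Fin (n + n) → K) ≃ₗ[K] (Fin (n + n) → K) :=
    E ≪≫ₗ (LinearEquiv.sumArrowLequivProdArrow (Fin n) (Fin n) K K).symm ≪≫ₗ
      LinearEquiv.funCongrLeft K K finSumFinEquiv.symm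
  let A : (Matrix (Fin (n + n)) (Fin (n + n)) K)ˣ :=
    ⟨LinearMap.toMatrix' F.toLinearMap, LinearMap.toMatrix' F.symm.toLinearMap,
      by rw [← LinearMap.toMatrix'_comp]; simp, by rw [← LinearMap.toMatrix'_comp]; simp⟩
  let M : Matrix (Fin n ⊕ Fin n) (Fin n ⊕ Fin n) K :=
    ((A : Matrix _ _ K) * P * ((A⁻¹ : (Matrix _ _ K)ˣ) : Matrix _ _ K)).submatrix
      finSumFinEquiv finSumFinEquiv
  have hM : M.toBlocks₁₁ = Q := by
    ext i j
    have e1 : (A : Matrix _ _ K) * P * ((A⁻¹ : (Matrix _ _ K)ˣ) : Matrix _ _ K) =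
        LinearMap.toMatrix' (F.toLinearMap ∘ₗ P.mulVecLin ∘ₗ F.symm.toLinearMap) := by
      rw [LinearMap.toMatrix'_comp, LinearMap.toMatrix'_comp, ← Matrix.toLin'_apply',
        LinearMap.toMatrix'_toLin', ← mul_assoc]
      rfl
    have e2 : F.symm (Pi.single (finSumFinEquiv (Sum.inl j)) 1) = u (Pi.single j 1) := by
      rw [← hE2, LinearEquiv.symm_apply_eq]
      ext a
      obtain ⟨a, rfl⟩ := finSumFinEquiv.surjective a
      rcases a with a | a <;>
      simp [F, LinearEquiv.funCongrLeft, LinearMap.funLeft, Pi.single_apply, LinearEquiv.sumArrowLequivProdArrow, Equiv.sumArrowEquivProdArrow]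
      simp only [Equiv.symm_apply_eq, finSumFinEquiv_apply_left]
    have e3 : ∀ v, F v (finSumFinEquiv (Sum.inl i)) = p v i := by
      intro v
      rw [← hE1]
      simp [F, LinearEquiv.funCongrLeft, LinearMap.funLeft]
      rfl
    change ((A : Matrix (Fin (n + n)) (Fin (n + n)) K) * P *
      ((A⁻¹ : (Matrix _ _ K)ˣ) : Matrix (Fin (n + n)) (Fin (n + n)) K) :
      Matrix (Fin (n + n)) (Fin (n + n)) K)
      (finSumFinEquiv (Sum.inl i)) (finSumFinEquiv (Sum.inl j)) = _
    rw [e1, LinearMap.toMatrix'_apply]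
    simp only [LinearMap.comp_apply, LinearEquiv.coe_coe]
    rw [e2, e3, h2]
    simp
  refine ⟨M.toBlocks₁₂, M.toBlocks₂₁, M.toBlocks₂₂, A, ?_⟩
  rw [← hM, Matrix.fromBlocks_toBlocks]
  ext a b
  simp [M]
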